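/- There is no cubic Galois extension of ℚ unramified outside 2: for every number field K such that K is a Galois extension of ℚ and [K : ℚ] = 3, there exists an odd prime number p such that p divides the discriminant of K. -/

import Mathlib

/-- If a group acts on a Dedekind domain, `P` is a stable prime with
residue field of two elements, then `σ x - x ∈ P ^ 2` on `P`. -/
theorem smul_sub_mem_sq {R : Type*} [CommRing R] [IsDedekindDomain R]
    {G : Type*} [Group G] [MulSemiringAction G R] (P : Ideal R) [P.IsPrime] (hP : P ≠ ⊥)
    (h2 : ∀ d : R, d ∈ P ∨ d - 1 ∈ P) (hG : ∀ (σ : G) (x : R), x ∈ P → σ • x ∈ P)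
    (hG2 : ∀ (σ : G) (x : R), x ∈ P ^ 2 → σ • x ∈ P ^ 2)
    (σ : G) (x : R) (hx : x ∈ P) (hx2 : x ∉ P ^ 2) : σ • x - x ∈ P ^ 2 := by
  obtain ⟨d, e, he, hde⟩ := Ideal.exists_mul_add_mem_pow_succ (P := P) hP (i := 1) x (σ • x)
    (by simpa using hx) hx2 (by simpa using hG σ x hx)
  rcases h2 d with hd | hd
  · exfalso
    apply hx2
    have : σ • x ∈ P ^ 2 := by
      rw [← hde]
      refine Ideal.add_mem _ ?_ he
      rw [pow_two]; exact Ideal.mul_mem_mul hx hd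
    simpa using hG2 σ⁻¹ _ this
  · have : σ • x - x = x * (d - 1) + e := by rw [← hde]; ring
    rw [this]
    refine Ideal.add_mem _ ?_ he
    rw [pow_two]; exact Ideal.mul_mem_mul hx hd

open scoped Pointwise in
/-- There is no cubic Galois extension of `ℚ` unramified outside `2`: every Galois number
field of degree `3` over `ℚ` has an odd prime dividing its discriminant. -/
theorem no_cubic_galois_unramified_outside_two
    (K : Type*) [Field K] [NumberField K] [IsGalois ℚ K]
    (hdeg : Module.finrank ℚ K = 3) :
    ∃ p : ℕ, p.Prime ∧ Odd p ∧ (p : ℤ) ∣ NumberField.discr K := by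
  by_contra hcon
  push Not at hcon
  have h2d : (2 : ℤ) ∣ NumberField.discr K := by
    have h := NumberField.abs_discr_gt_two (K := K) (by omega)
    obtain ⟨p, hp1, hp2⟩ := Nat.exists_prime_and_dvd (n := (NumberField.discr K).natAbs)
      (by rw [Int.abs_eq_natAbs] at h; omega)
    have hp3 : (p : ℤ) ∣ NumberField.discr K := Int.natCast_dvd.mpr hp2
    rcases hp1.eq_two_or_odd' with rfl | ho
    · exact_mod_cast hp3
    · exact absurd hp3 (hcon p hp1 ho)
  have hp2 : Prime (2 : ℤ) := Int.prime_two
  have hram := mt (NumberField.not_dvd_discr_iff_forall_liesOver K (NumberField.RingOfIntegers K)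
    hp2).mpr (not_not.mpr h2d)
  push Not at hram
  obtain ⟨P, hPmax, hPover, hPram⟩ := hram
  have hspan : (Ideal.span {(2 : ℤ)}).IsPrime :=
    (Ideal.span_singleton_prime (by norm_num)).mpr hp2
  have hspanmax : (Ideal.span {(2 : ℤ)}).IsMaximal := hspan.isMaximal (by simp)
  have hPprime := hPmax.isPrime
  have hPbot : P ≠ ⊥ := Ideal.IsMaximal.ne_bot_of_isIntegral_int _
  have hcard : Nat.card Gal(K/ℚ) = 3 := by rw [IsGalois.card_aut_eq_finrank, hdeg]
  have hfund := Ideal.ncard_primesOver_mul_ramificationIdxIn_mul_inertiaDegIn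
    (Ideal.span {(2 : ℤ)}) (NumberField.RingOfIntegers K) Gal(K/ℚ)
  rw [hcard, Ideal.ramificationIdxIn_eq_ramificationIdx _ P Gal(K/ℚ),
    Ideal.inertiaDegIn_eq_inertiaDeg _ P Gal(K/ℚ)] at hfund
  have he : P.ramificationIdx ℤ ≠ 1 := by
    rwa [Ne, Ideal.ramificationIdx_eq_one_iff]
  have he3 : P.ramificationIdx ℤ = 3 :=
    ((Nat.dvd_prime Nat.prime_three).mp
      (Dvd.dvd.trans (dvd_mul_right _ _) (Dvd.intro_left _ hfund))).resolve_left he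
  rw [he3] at hfund
  have hgf : (Ideal.primesOver (Ideal.span {(2 : ℤ)}) (NumberField.RingOfIntegers K)).ncard *
    P.inertiaDeg ℤ = 1 := by linarith
  obtain ⟨hg, hf⟩ := mul_eq_one.mp hgf
  have h2P : (2 : NumberField.RingOfIntegers K) ∈ P ^ 2 := by
    have h := (Ideal.ramificationIdx'_ne_one_iff (p := Ideal.span {(2 : ℤ)}) (P := P)
      (Ideal.map_le_iff_le_comap.mpr (hPover.over).le)).mp ?_
    · have := h (Ideal.mem_map_of_mem _ (Ideal.mem_span_singleton_self (2 : ℤ)))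
      simpa using this
    · rw [Ideal.ramificationIdx'_eq_ramificationIdx _ _ (by simp)]
      exact he
  have hres : ∀ d : NumberField.RingOfIntegers K, d ∈ P ∨ d - 1 ∈ P := by
    have hN := Ideal.absNorm_eq_pow_inertiaDeg P hp2
    rw [Ideal.inertiaDeg'_eq_inertiaDeg, hf] at hN
    have hN' : Nat.card (NumberField.RingOfIntegers K ⧸ P) = 2 := by
      simpa [Ideal.absNorm_apply, Submodule.cardQuot_apply] using hN
    intro d
    obtain ⟨x, y, hxy, hu⟩ := Nat.card_eq_two_iff.mp hN'
    have key : ∀ z : NumberField.RingOfIntegers K ⧸ P, z = 0 ∨ z = 1 := by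
      have hm : ∀ z : NumberField.RingOfIntegers K ⧸ P, z = x ∨ z = y := fun z => by
        have : z ∈ ({x, y} : Set _) := hu ▸ Set.mem_univ z
        simpa using this
      have h01 : (0 : NumberField.RingOfIntegers K ⧸ P) ≠ 1 := zero_ne_one
      intro z
      have h0 := hm 0
      have h1 := hm 1
      have h2 := hm z
      grind
    rcases key (Ideal.Quotient.mk P d) with h | h
    · exact Or.inl (Ideal.Quotient.eq_zero_iff_mem.mp h)
    · right
      rw [← Ideal.Quotient.eq_zero_iff_mem, map_sub, h, map_one, sub_self]
  have hstab : ∀ σ : Gal(K/ℚ), σ • P = P := by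
    intro σ
    obtain ⟨Q, hQ⟩ := Set.ncard_eq_one.mp hg
    have h1 : P ∈ Ideal.primesOver (Ideal.span {(2 : ℤ)}) (NumberField.RingOfIntegers K) :=
      ⟨hPprime, hPover⟩
    have h2 : σ • P ∈ Ideal.primesOver (Ideal.span {(2 : ℤ)}) (NumberField.RingOfIntegers K) :=
      ⟨inferInstance, inferInstance⟩
    rw [hQ] at h1 h2
    exact h2.trans h1.symm
  have hG : ∀ (σ : Gal(K/ℚ)) (x : NumberField.RingOfIntegers K), x ∈ P → σ • x ∈ P := by
    intro σ x hx
    have := Ideal.smul_mem_pointwise_smul σ x P hx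
    rwa [hstab] at this
  have hG2 : ∀ (σ : Gal(K/ℚ)) (x : NumberField.RingOfIntegers K), x ∈ P ^ 2 → σ • x ∈ P ^ 2 := by
    intro σ x hx
    have := Ideal.smul_mem_pointwise_smul σ x (P ^ 2) hx
    rwa [smul_pow', hstab] at this
  obtain ⟨x, hx, hx2⟩ : ∃ x ∈ P, x ∉ P ^ 2 := by
    have := Ideal.pow_succ_lt_pow hPbot 1
    rw [pow_one] at this
    exact SetLike.exists_of_lt this
  have hsub : ∑ σ : Gal(K/ℚ), (σ • x - x) ∈ P ^ 2 :=
    Ideal.sum_mem _ fun σ _ => smul_sub_mem_sq P hPbot hres hG hG2 σ x hx hx2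
  have hsum : ∑ σ : Gal(K/ℚ), σ • x ∈ P := Ideal.sum_mem _ fun σ _ => hG σ x hx
  obtain ⟨a, ha⟩ := (IsGaloisGroup.isInvariant (G := Gal(K/ℚ)) (A := ℤ)
    (B := NumberField.RingOfIntegers K)).isInvariant (∑ σ : Gal(K/ℚ), σ • x) (by
      intro g
      rw [Finset.smul_sum]
      simp_rw [← mul_smul]
      exact Fintype.sum_equiv (Equiv.mulLeft g) _ _ (fun _ => rfl))
  have ha2 : a ∈ Ideal.span {(2 : ℤ)} := by
    rw [hPover.over, Ideal.mem_comap, ha]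
    exact hsum
  obtain ⟨b, rfl⟩ := Ideal.mem_span_singleton.mp ha2
  have hsum2 : ∑ σ : Gal(K/ℚ), σ • x ∈ P ^ 2 := by
    rw [← ha, map_mul]
    exact Ideal.mul_mem_right _ _ (by simpa using h2P)
  rw [Finset.sum_sub_distrib, Finset.sum_const, Finset.card_univ, ← Nat.card_eq_fintype_card,
    hcard] at hsub
  apply hx2
  have : x = (∑ σ : Gal(K/ℚ), σ • x) - (∑ σ : Gal(K/ℚ), σ • x - 3 • x) - 2 * x := by
    rw [nsmul_eq_mul]; push_cast; ring
  rw [this]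
  exact Ideal.sub_mem _ (Ideal.sub_mem _ hsum2 hsub) (Ideal.mul_mem_right _ _ h2P)
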